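/- Let λ, μ ∈ ℝ with μ > 0 and 3λ + 2μ > 0, and let r₀, E₀ > 0, D₀ > 1. There exist R₀ ≥ 3D₀ and c > 0, depending only on λ, μ, r₀, E₀, D₀, such that for every Lipschitz cavity C with parameters r₀, E₀, D₀, every p > 0, every normalized solution w of the cavity problem in Ω = ℝ³₋ \ C̄, and every R ≥ R₀, one has the energy lower bound ∫_{B⁻_R(0) \ C} |∇̂w|² dx ≥ c p² R³. -/

import Mathlib

open MeasureTheory Metric Set

noncomputable section

abbrev E3 := EuclideanSpace ℝ (Fin 3)
abbrev E2 := EuclideanSpace ℝ (Fin 2)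

/-- The open lower half-space `{x : x₃ < 0}`. -/
def lowerHalf : Set E3 := {x | x 2 < 0}

/-- The lower half-ball `B⁻_r(0) = {|x| < r, x₃ < 0}`. -/
def negBall (r : ℝ) : Set E3 := {x | ‖x‖ < r ∧ x 2 < 0}

/-- Jacobian matrix of a vector field: `(jac u x) i j = ∂uᵢ/∂xⱼ (x)`. -/
def jac (u : E3 → E3) (x : E3) : Matrix (Fin 3) (Fin 3) ℝ :=
  fun i j => fderiv ℝ u x (EuclideanSpace.single j 1) i

/-- Symmetric part of the Jacobian (strain tensor) `∇̂u`. -/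
def strain (u : E3 → E3) (x : E3) : Matrix (Fin 3) (Fin 3) ℝ :=
  fun i j => (jac u x i j + jac u x j i) / 2

/-- Squared Frobenius norm of a 3×3 matrix. -/
def frob2 (M : Matrix (Fin 3) (Fin 3) ℝ) : ℝ := ∑ i, ∑ j, (M i j)^2

/-- Divergence of a vector field. -/
def divg (u : E3 → E3) (x : E3) : ℝ := ∑ i, jac u x i i

/-- Projection on the first two coordinates. -/
def proj12 (x : E3) : E2 :=
  (x 0) • EuclideanSpace.single 0 1 + (x 1) • EuclideanSpace.single 1 1

/-- Embedding of the plane `{x₃ = 0}` into `ℝ³`: `x' ↦ (x'₁, x'₂, 0)`. -/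
def emb2 (x' : E2) : E3 :=
  (x' 0) • EuclideanSpace.single 0 1 + (x' 1) • EuclideanSpace.single 1 1

/-- Partial derivative of a scalar field in the k-th coordinate direction. -/
def pd (f : E3 → ℝ) (k : Fin 3) (x : E3) : ℝ := fderiv ℝ f x (EuclideanSpace.single k 1)

/-- `S` has boundary of Lipschitz class with constants r₀, E₀: at each boundary point `P`,
after a rigid change of coordinates sending `P` to `0`, the set is locally the open
epigraph of a Lipschitz function `ψ` with `ψ 0 = 0` and Lipschitz constant at most `E₀`. -/
def HasLipschitzBoundary (r₀ E₀ : ℝ) (S : Set E3) : Prop :=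
  ∀ P ∈ frontier S, ∃ (φ : E3 ≃ᵢ E3) (ψ : E2 → ℝ),
    φ P = 0 ∧ ψ 0 = 0 ∧ LipschitzOnWith (Real.toNNReal E₀) ψ (Metric.ball 0 r₀) ∧
    (φ '' S) ∩ Metric.ball 0 r₀ = {x ∈ Metric.ball (0 : E3) r₀ | ψ (proj12 x) < x 2}

/-- `S` has boundary of class C³ with constants r₀, E₀. -/
def HasC3Boundary (r₀ E₀ : ℝ) (S : Set E3) : Prop :=
  ∀ P ∈ frontier S, ∃ (φ : E3 ≃ᵢ E3) (ψ : E2 → ℝ),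
    φ P = 0 ∧ ψ 0 = 0 ∧ ContDiff ℝ 3 ψ ∧ fderiv ℝ ψ 0 = 0 ∧
    (∀ x' ∈ Metric.ball (0 : E2) r₀, ∀ k : ℕ, k ≤ 3 → ‖iteratedFDeriv ℝ k ψ x'‖ ≤ E₀) ∧
    (φ '' S) ∩ Metric.ball 0 r₀ = {x ∈ Metric.ball (0 : E3) r₀ | ψ (proj12 x) < x 2}

/-- Geometric a priori assumptions on a cavity: bounded open set, closure inside the lower
half-space, connected complement in the half-space, contained in `B⁻_{2D₀}(0)`, at distance
at least `D₀` from the plane `{x₃ = 0}`, with diameter less than `D₀`. -/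
def IsCavity (D₀ : ℝ) (C : Set E3) : Prop :=
  IsOpen C ∧ Bornology.IsBounded C ∧ closure C ⊆ lowerHalf ∧
  IsConnected (lowerHalf \ closure C) ∧ C ⊆ negBall (2*D₀) ∧
  (∀ x ∈ C, x 2 ≤ -D₀) ∧ Metric.diam C < D₀

/-- Lipschitz cavity with parameters r₀, E₀, D₀. -/
def IsLipschitzCavity (r₀ E₀ D₀ : ℝ) (C : Set E3) : Prop :=
  IsCavity D₀ C ∧ HasLipschitzBoundary r₀ E₀ C

/-- C³ cavity with parameters r₀, E₀, D₀. -/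
def IsC3Cavity (r₀ E₀ D₀ : ℝ) (C : Set E3) : Prop :=
  IsCavity D₀ C ∧ HasC3Boundary r₀ E₀ C

/-- Normalized solution `w = u − ū` of the cavity problem (with `ū(x) = (p/(3λ+2μ)) x`):
`w` is continuous up to the boundary plane, C¹ on `Ω = ℝ³₋ \ C̄`, `w + ū` lies in the
weighted class, and `w` satisfies the variational identity
`∫_Ω ℂ∇̂w : ∇̂v = −p ∫_{ℝ²} v₃(x₁,x₂,0) dx₁dx₂` for all smooth compactly supported `v`. -/
def IsNormalizedSolution (lam mu p : ℝ) (C : Set E3) (w : E3 → E3) : Prop :=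
  ContinuousOn w ({x : E3 | x 2 ≤ 0} \ closure C) ∧
  ContDiffOn ℝ 1 w (lowerHalf \ closure C) ∧
  IntegrableOn (fun x => ‖w x + (p / (3*lam+2*mu)) • x‖^2 / (1 + ‖x‖^2)) (lowerHalf \ closure C) ∧
  IntegrableOn
    (fun x => frob2 (fun i j => jac w x i j + (p/(3*lam+2*mu)) * (if i = j then 1 else 0)))
    (lowerHalf \ closure C) ∧
  ∀ v : E3 → E3, ContDiff ℝ (⊤ : ℕ∞) v → HasCompactSupport v →
    ∫ x in lowerHalf \ closure C,
        (lam * divg w x * divg v x + 2 * mu * ∑ i, ∑ j, strain w x i j * strain v x i j)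
      = -p * ∫ x' : E2, v (emb2 x') 2

lemma elb_meas_jac (w : E3 → E3) (i j : Fin 3) : Measurable (fun x => jac w x i j) := by
  have h := measurable_fderiv_apply_const ℝ w (EuclideanSpace.single j (1:ℝ))
  have h2 : Measurable (fun y : E3 => y i) := by fun_prop
  exact h2.comp h

lemma elb_meas_frob (w : E3 → E3) : Measurable (fun x => frob2 (strain w x)) := by
  unfold frob2 strain
  have := elb_meas_jac w
  fun_prop

lemma elb_frob_nonneg (M : Matrix (Fin 3) (Fin 3) ℝ) : 0 ≤ frob2 M := by
  unfold frob2; positivity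

lemma elb_strain_le (w : E3 → E3) (x : E3) (a : ℝ) :
    frob2 (strain w x) ≤
      2 * frob2 (fun i j => jac w x i j + a * (if i = j then 1 else 0)) + 6 * a ^ 2 := by
  simp only [frob2, strain, Fin.sum_univ_three]
  simp
  nlinarith [sq_nonneg (jac w x 0 0 + 2 * a), sq_nonneg (jac w x 1 1 + 2 * a),
    sq_nonneg (jac w x 2 2 + 2 * a), sq_nonneg (jac w x 0 1 - jac w x 1 0),
    sq_nonneg (jac w x 0 2 - jac w x 2 0), sq_nonneg (jac w x 1 2 - jac w x 2 1),
    sq_nonneg (jac w x 0 1), sq_nonneg (jac w x 0 2), sq_nonneg (jac w x 1 2),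
    sq_nonneg (jac w x 1 0), sq_nonneg (jac w x 2 0), sq_nonneg (jac w x 2 1)]

lemma elb_young (a s t e m : ℝ) (he : 0 < e) (ht : |t| ≤ m) :
    -(a * s * t) ≤ e / 2 * s ^ 2 + a ^ 2 * m ^ 2 / (2 * e) := by
  have h1 : t ^ 2 ≤ m ^ 2 := by
    rw [← sq_abs t]; exact pow_le_pow_left₀ (abs_nonneg t) ht 2
  have h2 : -(a * s * t) ≤ e / 2 * s ^ 2 + a ^ 2 * t ^ 2 / (2 * e) := by
    have : e / 2 * s ^ 2 + a ^ 2 * t ^ 2 / (2 * e) + a * s * t = (e * s + a * t) ^ 2 / (2 * e) := by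
      field_simp; ring
    have h3 : 0 ≤ (e * s + a * t) ^ 2 / (2 * e) := by positivity
    linarith
  have h4 : a ^ 2 * t ^ 2 / (2 * e) ≤ a ^ 2 * m ^ 2 / (2 * e) := by gcongr
  linarith

lemma elb_point (lam mu e m : ℝ) (he : 0 < e) (w v : E3 → E3) (x : E3)
    (hv : ∀ i j, |jac v x i j| ≤ m) :
    -(lam * divg w x * divg v x + 2 * mu * ∑ i, ∑ j, strain w x i j * strain v x i j) ≤
      e * frob2 (strain w x) + (27 * lam ^ 2 + 36 * mu ^ 2) * m ^ 2 / (2 * e) := by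
  have hs : ∀ i j, |strain v x i j| ≤ m := by
    intro i j
    have h1 := abs_le.1 (hv i j)
    have h2 := abs_le.1 (hv j i)
    unfold strain
    rw [abs_le]; constructor <;> linarith [h1.1, h1.2, h2.1, h2.2]
  have hd : |divg v x| ≤ 3 * m := by
    unfold divg
    rw [Fin.sum_univ_three]
    have h1 := abs_le.1 (hv 0 0)
    have h2 := abs_le.1 (hv 1 1)
    have h3 := abs_le.1 (hv 2 2)
    rw [abs_le]; constructor <;> linarith [h1.1, h1.2, h2.1, h2.2, h3.1, h3.2]
  have hdw : divg w x = strain w x 0 0 + strain w x 1 1 + strain w x 2 2 := by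
    simp only [divg, strain, Fin.sum_univ_three]; ring
  have hD := fun i => elb_young lam (strain w x i i) (divg v x) e (3 * m) he hd
  have hS := fun i j => elb_young (2 * mu) (strain w x i j) (strain v x i j) e m he (hs i j)
  have e1 : (27 * lam ^ 2 + 36 * mu ^ 2) * m ^ 2 / (2 * e)
      = 3 * (lam ^ 2 * (3 * m) ^ 2 / (2 * e)) + 9 * ((2 * mu) ^ 2 * m ^ 2 / (2 * e)) := by
    field_simp; ring
  have hoff : ∀ i j, 0 ≤ e / 2 * (strain w x i j) ^ 2 := fun i j => by positivity
  rw [e1, hdw]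
  simp only [frob2, Fin.sum_univ_three]
  linarith [hD 0, hD 1, hD 2, hS 0 0, hS 0 1, hS 0 2, hS 1 0, hS 1 1, hS 1 2, hS 2 0, hS 2 1,
    hS 2 2, hoff 0 1, hoff 0 2, hoff 1 0, hoff 1 2, hoff 2 0, hoff 2 1]

lemma elb_emb_norm (y : E2) : ‖emb2 y‖ = ‖y‖ := by
  simp [EuclideanSpace.norm_eq, emb2, Fin.sum_univ_three, Fin.sum_univ_two]

lemma elb_emb_cont : Continuous emb2 := by
  unfold emb2; fun_prop

/-- The fixed test field. -/
lemma elb_test : ∃ (V : E3 → E3) (M a : ℝ), ContDiff ℝ (⊤ : ℕ∞) V ∧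
    (∀ x, 1 ≤ ‖x‖ → V x = 0 ∧ fderiv ℝ V x = 0) ∧ (∀ x, ‖fderiv ℝ V x‖ ≤ M) ∧
    0 < M ∧ 0 < a ∧ ∫ y : E2, V (emb2 y) 2 = a := by
  let φ : ContDiffBump (0 : E3) := ⟨1/4, 1/2, by norm_num, by norm_num⟩
  let V : E3 → E3 := fun x => φ x • EuclideanSpace.single 2 (1:ℝ)
  have hVs : ContDiff ℝ (⊤ : ℕ∞) V := φ.contDiff.smul contDiff_const
  have hV0 : ∀ x : E3, 1/2 ≤ ‖x‖ → V x = 0 := by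
    intro x hx
    have : φ x = 0 := φ.zero_of_le_dist (by simpa [φ] using hx)
    simp [V, this]
  have hcs : HasCompactSupport V := HasCompactSupport.intro (isCompact_closedBall (0:E3) (1/2))
    (fun x hx => hV0 x (by simp at hx; linarith))
  have hc : Continuous (fderiv ℝ V) := hVs.continuous_fderiv (by simp)
  obtain ⟨M, hM⟩ := (hcs.fderiv ℝ).exists_bound_of_continuous hc
  have hval : ∀ y : E2, V (emb2 y) 2 = φ (emb2 y) := by intro y; simp [V]
  refine ⟨V, max M 1, _, hVs, ?_, fun x => (hM x).trans (le_max_left _ _), by positivity, ?_, rfl⟩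
  · intro x hx
    refine ⟨hV0 x (by linarith), ?_⟩
    have : V =ᶠ[nhds x] fun _ => 0 := by
      have hn : {z : E3 | 1/2 < ‖z‖} ∈ nhds x :=
        (isOpen_lt continuous_const continuous_norm).mem_nhds (by simp; linarith)
      filter_upwards [hn] with z hz using hV0 z (le_of_lt hz)
    rw [this.fderiv_eq]; simp
  · simp only [hval]
    refine Continuous.integral_pos_of_hasCompactSupport_nonneg_nonzero (x := 0)
      (φ.continuous.comp elb_emb_cont) ?_ (fun y => φ.nonneg) ?_
    · refine HasCompactSupport.intro (isCompact_closedBall (0:E2) (1/2)) (fun y hy => ?_)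
      refine φ.zero_of_le_dist ?_
      simp at hy
      simp [φ, elb_emb_norm]; linarith
    · have : emb2 0 = 0 := by simp [emb2]
      rw [this]
      exact ne_of_gt (φ.pos_of_mem_ball (by simp [φ]))

/-- Lower bound for the strain energy of a normalized solution of the cavity problem on
large half-balls: `∫_{B⁻_R \ C} |∇̂w|² ≥ c p² R³`. -/
theorem energy_lower_bound (lam mu r₀ E₀ D₀ : ℝ)
    (hmu : 0 < mu) (hlam : 0 < 3*lam + 2*mu) (hr₀ : 0 < r₀) (hE₀ : 0 < E₀) (hD₀ : 1 < D₀) :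
    ∃ R₀ c : ℝ, 3*D₀ ≤ R₀ ∧ 0 < c ∧
      ∀ C : Set E3, IsLipschitzCavity r₀ E₀ D₀ C → ∀ p : ℝ, 0 < p →
      ∀ w : E3 → E3, IsNormalizedSolution lam mu p C w →
      ∀ R : ℝ, R₀ ≤ R →
      c * p^2 * R^3 ≤ ∫ x in negBall R \ closure C, frob2 (strain w x) := by
  obtain ⟨V, M, a, hVs, hV0, hVM, hM, ha, hVa⟩ := elb_test
  set K : ℝ := 27 * lam ^ 2 + 36 * mu ^ 2 with hK
  have hKpos : 0 < K := by positivity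
  set B : ℝ := volume.real (ball (0:E3) 1) with hB
  have hBpos : 0 < B := by
    rw [hB, measureReal_def]
    exact ENNReal.toReal_pos (measure_ball_pos volume _ one_pos).ne' measure_ball_lt_top.ne
  refine ⟨3 * D₀, a ^ 2 / (2 * K * M ^ 2 * B), le_rfl, by positivity, ?_⟩
  intro C hC p hp w ⟨_, _, _, hint, hweak⟩ R hR
  have hRpos : 0 < R := by linarith
  set A : Set E3 := negBall R \ closure C with hA
  have hAΩ : A ⊆ lowerHalf \ closure C := fun x hx => ⟨hx.1.2, hx.2⟩
  have hAball : A ⊆ ball 0 R := fun x hx => by simpa using hx.1.1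
  have hco : Continuous (fun x : E3 => x 2) := by fun_prop
  have hΩm : MeasurableSet (lowerHalf \ closure C) :=
    (isOpen_lt hco continuous_const).measurableSet.diff isClosed_closure.measurableSet
  have hAm : MeasurableSet A :=
    ((isOpen_lt continuous_norm continuous_const).inter
      (isOpen_lt hco continuous_const)).measurableSet.diff isClosed_closure.measurableSet
  have hAfin : volume A ≠ ⊤ := ((measure_mono hAball).trans_lt measure_ball_lt_top).ne
  have hAvol : volume.real A ≤ R ^ 3 * B := by
    have h1 : volume.real A ≤ volume.real (ball (0:E3) R) :=
      measureReal_mono hAball measure_ball_lt_top.ne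
    have h2 : volume.real (ball (0:E3) R) = R ^ 3 * B := by
      rw [measureReal_def, Measure.addHaar_ball_of_pos volume (0:E3) hRpos]; simp [hB, measureReal_def, hRpos.le]
    linarith
  -- integrability of the energy density
  have hSint : IntegrableOn (fun x => frob2 (strain w x)) A := by
    have h1 := (((hint.mono_set hAΩ).const_mul 2).add
      (integrableOn_const (C := 6 * (p / (3*lam+2*mu)) ^ 2) hAfin))
    refine Integrable.mono' h1 (elb_meas_frob w).aestronglyMeasurable (ae_of_all _ fun x => ?_)
    rw [Real.norm_of_nonneg (elb_frob_nonneg _)]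
    exact elb_strain_le w x _
  set En : ℝ := ∫ x in A, frob2 (strain w x) with hEn
  -- test field
  let v : E3 → E3 := fun x => V (R⁻¹ • x)
  have hnorm : ∀ x : E3, R ≤ ‖x‖ → 1 ≤ ‖R⁻¹ • x‖ := by
    intro x hx
    rw [norm_smul, Real.norm_of_nonneg (by positivity), inv_mul_eq_div, one_le_div hRpos]
    exact hx
  have hvs : ContDiff ℝ (⊤ : ℕ∞) v := hVs.comp (contDiff_const_smul _)
  have hvc : HasCompactSupport v := HasCompactSupport.intro (isCompact_closedBall (0:E3) R)
    (fun x hx => (hV0 _ (hnorm x (by simp at hx; linarith))).1)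
  have hfd : ∀ x, fderiv ℝ v x = R⁻¹ • fderiv ℝ V (R⁻¹ • x) := fun x => fderiv_comp_smul _
  have hjac : ∀ x i j, |jac v x i j| ≤ M / R := by
    intro x i j
    unfold jac
    have h1 : |fderiv ℝ v x (EuclideanSpace.single j 1) i| ≤
        ‖fderiv ℝ v x (EuclideanSpace.single j 1)‖ := by
      simpa using PiLp.norm_apply_le (fderiv ℝ v x (EuclideanSpace.single j 1)) i
    have h2 : ‖fderiv ℝ v x (EuclideanSpace.single j 1)‖ ≤ ‖fderiv ℝ v x‖ := by
      simpa using (fderiv ℝ v x).le_opNorm (EuclideanSpace.single j (1:ℝ))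
    have h3 : ‖fderiv ℝ v x‖ ≤ M / R := by
      rw [hfd, norm_smul, Real.norm_of_nonneg (by positivity), inv_mul_eq_div]
      gcongr
      exact hVM _
    linarith
  have hjac0 : ∀ x, R ≤ ‖x‖ → ∀ i j, jac v x i j = 0 := by
    intro x hx i j
    simp [jac, hfd, (hV0 _ (hnorm x hx)).2]
  have hrhs : ∫ y : E2, v (emb2 y) 2 = R ^ 2 * a := by
    have h1 : ∀ y : E2, v (emb2 y) 2 = (fun z => V (emb2 z) 2) (R⁻¹ • y) := by
      intro y
      have : emb2 (R⁻¹ • y) = R⁻¹ • emb2 y := by simp [emb2, smul_smul]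
      simp [v, this]
    simp only [h1]
    rw [Measure.integral_comp_inv_smul_of_nonneg volume (fun z => V (emb2 z) 2) hRpos.le, hVa]
    simp
  have key := hweak v hvs hvc
  rw [hrhs] at key
  set g : E3 → ℝ := fun x =>
    (lam * divg w x * divg v x + 2 * mu * ∑ i, ∑ j, strain w x i j * strain v x i j) with hg
  have hgA : ∫ x in lowerHalf \ closure C, g x = ∫ x in A, g x := by
    refine (setIntegral_eq_of_subset_of_forall_sdiff_eq_zero hΩm hAΩ fun x hx => ?_)
    have hx' : R ≤ ‖x‖ := by
      by_contra hlt
      exact hx.2 ⟨⟨not_le.1 hlt, hx.1.1⟩, hx.1.2⟩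
    simp [hg, divg, strain, hjac0 x hx']
  have hmain : ∀ e : ℝ, 0 < e → p * (R ^ 2 * a) ≤ e * En + K * M ^ 2 * B * R / (2 * e) := by
    intro e he
    have hq : IntegrableOn (fun x => e * frob2 (strain w x) + K * (M / R) ^ 2 / (2 * e)) A :=
      (hSint.const_mul e).add (integrableOn_const hAfin)
    have h1 : -∫ x in A, g x ≤
        ∫ x in A, (e * frob2 (strain w x) + K * (M / R) ^ 2 / (2 * e)) := by
      by_cases hgi : IntegrableOn g A
      · rw [← integral_neg]
        exact integral_mono hgi.neg hq (fun x => elb_point lam mu e (M / R) he w v x (hjac x))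
      · rw [integral_undef hgi, neg_zero]
        refine integral_nonneg fun x => ?_
        have := elb_frob_nonneg (strain w x)
        simp only [Pi.zero_apply]
        positivity
    have h2 : ∫ x in A, (e * frob2 (strain w x) + K * (M / R) ^ 2 / (2 * e)) =
        e * En + volume.real A * (K * (M / R) ^ 2 / (2 * e)) := by
      rw [integral_add (hSint.const_mul e) (integrableOn_const hAfin), integral_const_mul,
        setIntegral_const, smul_eq_mul]
    have h3 : volume.real A * (K * (M / R) ^ 2 / (2 * e)) ≤
        R ^ 3 * B * (K * (M / R) ^ 2 / (2 * e)) := by gcongr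
    have h4 : R ^ 3 * B * (K * (M / R) ^ 2 / (2 * e)) = K * M ^ 2 * B * R / (2 * e) := by
      field_simp
    rw [hgA] at key
    linarith
  have hfin := hmain (K * M ^ 2 * B / (p * R * a)) (by positivity)
  have h5 : K * M ^ 2 * B * R / (2 * (K * M ^ 2 * B / (p * R * a))) = p * (R ^ 2 * a) / 2 := by
    field_simp
  rw [h5] at hfin
  have h6 : p * (R ^ 2 * a) / 2 ≤ K * M ^ 2 * B / (p * R * a) * En := by linarith
  have h7 : a ^ 2 / (2 * K * M ^ 2 * B) * p ^ 2 * R ^ 3 =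
      (p * R * a) / (K * M ^ 2 * B) * (p * (R ^ 2 * a) / 2) := by
    field_simp
  have h8 : En = (p * R * a) / (K * M ^ 2 * B) * (K * M ^ 2 * B / (p * R * a) * En) := by
    field_simp
  rw [h7, h8]
  gcongr

end
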